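/- arXiv:2104.04919 — 2 statements merged into one kernel-verified Lean document; each statement's English description precedes it below -/
import Mathlib

section
/- Let G be one of the groups C6, D6 (dihedral of order 12), C2³⋊C3, or C2³⋊S3 (with C3 resp. S3 acting on C2³ by permuting the coordinates). If H₁ and H₂ are subgroups of the symmetric group S6 on a six-element set that both act transitively on the six points and are both isomorphic to G, then H₁ and H₂ are conjugate in S6. -/
noncomputable section

/-- The group `C₂³`, a product of three copies of the cyclic group of order 2. -/
abbrev C2cube : Type := Fin 3 → Multiplicative (ZMod 2)

/-- The action of a permutation of the indices on `C₂³`. -/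
def permHom : Equiv.Perm (Fin 3) →* MulAut C2cube where
  toFun σ := MulEquiv.arrowCongr σ (MulEquiv.refl (Multiplicative (ZMod 2)))
  map_one' := by ext f i; rfl
  map_mul' σ τ := by ext f i; rfl

/-- The cyclic subgroup of order 3 of `S₃` generated by the 3-cycle `finRotate 3`. -/
def C3rot : Subgroup (Equiv.Perm (Fin 3)) := Subgroup.zpowers (finRotate 3)

/-- The cyclic group `C₆` of order 6. -/
abbrev GrpC6 : Type := Multiplicative (ZMod 6)

/-- The dihedral group `D₆` of order 12. -/
abbrev GrpD6 : Type := DihedralGroup 6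

/-- The semidirect product `C₂³ ⋊ C₃`, with `C₃` cyclically permuting the coordinates. -/
abbrev GrpC23C3 : Type := C2cube ⋊[permHom.comp C3rot.subtype] C3rot

/-- The semidirect product `C₂³ ⋊ S₃`, with `S₃` permuting the coordinates. -/
abbrev GrpC23S3 : Type := C2cube ⋊[permHom] Equiv.Perm (Fin 3)

/-- A permutation `r` of six points with `r ^ 6 = 1`, `r ^ 2 ≠ 1` and `r ^ 3` fixed-point-free is
conjugate to `finRotate 6`. -/
theorem exists_conj_finRotate_six {r : Equiv.Perm (Fin 6)} (h6 : r ^ 6 = 1) (h2 : r ^ 2 ≠ 1)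
    (h3 : ∀ x, (r ^ 3) x ≠ x) :
    ∃ g : Equiv.Perm (Fin 6), g * r * g⁻¹ = finRotate 6 := by
  obtain ⟨x, hx⟩ : ∃ x, (r ^ 2) x ≠ x := by
    by_contra! h
    exact h2 (Equiv.ext h)
  have hper (n : ℕ) : (r ^ n) x = x ↔ Function.minimalPeriod r x ∣ n := by
    rw [← Function.isPeriodicPt_iff_minimalPeriod_dvd, Function.IsPeriodicPt,
      Function.IsFixedPt, Equiv.Perm.iterate_eq_pow]
  have hmin : Function.minimalPeriod r x = 6 := by
    have hd6 : Function.minimalPeriod r x ∣ 6 := (hper 6).1 (by simp [h6])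
    have hd3 : ¬ Function.minimalPeriod r x ∣ 3 := fun h => h3 x ((hper 3).2 h)
    have hd2 : ¬ Function.minimalPeriod r x ∣ 2 := fun h => hx ((hper 2).2 h)
    have hle := Nat.le_of_dvd (by norm_num) hd6
    generalize Function.minimalPeriod r x = m at *
    interval_cases m <;> simp_all +decide
  have hinj : Function.Injective fun i : Fin 6 => (r ^ (i : ℕ)) x := by
    intro i j hij
    have hi : (i : ℕ) < Function.minimalPeriod r x := by rw [hmin]; exact i.2
    have hj : (j : ℕ) < Function.minimalPeriod r x := by rw [hmin]; exact j.2
    refine Fin.ext ((Function.iterate_injOn_Iio_minimalPeriod (f := r)) hi hj ?_)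
    simpa [Equiv.Perm.iterate_eq_pow] using hij
  let e : Equiv.Perm (Fin 6) := Equiv.ofBijective _ (Finite.injective_iff_bijective.1 hinj)
  have he (i : Fin 6) : e i = (r ^ (i : ℕ)) x := rfl
  refine ⟨e⁻¹, ?_⟩
  rw [inv_inv, mul_assoc, inv_mul_eq_iff_eq_mul]
  ext1 i
  rw [Equiv.Perm.mul_apply, Equiv.Perm.mul_apply, he, he, ← Equiv.Perm.mul_apply, ← pow_succ']
  fin_cases i <;> first | rfl | simp [h6]

theorem orderOf_finRotate_six : orderOf (finRotate 6) = 6 := by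
  simpa using (isCycle_finRotate (n := 4)).orderOf

theorem finRotate_six_pow_apply (i x : Fin 6) : (finRotate 6 ^ (i : ℕ)) x = x + i := by
  revert i x
  decide +kernel

theorem card_centralizer_finRotate_six_pow_three :
    Nat.card (Subgroup.centralizer {finRotate 6 ^ 3}) = 48 := by
  have h : Fintype.card {g : Equiv.Perm (Fin 6) // ∀ x, g (x + 3) = g x + 3} = 48 := by
    decide +kernel
  rw [← h, ← Nat.card_eq_fintype_card]
  have hmem (g : Equiv.Perm (Fin 6)) :
      g ∈ Subgroup.centralizer {finRotate 6 ^ 3} ↔ ∀ x, g (x + 3) = g x + 3 := by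
    simp only [Subgroup.mem_centralizer_singleton_iff, Equiv.ext_iff, Equiv.Perm.mul_apply,
      finRotate_six_pow_apply 3, show (3 : ℕ) = ((3 : Fin 6) : ℕ) from rfl]
  exact Nat.card_congr (Equiv.subtypeEquivRight hmem)

theorem card_normalizer_zpowers_finRotate_six_le :
    Nat.card (Subgroup.normalizer (Subgroup.zpowers (finRotate 6) : Set (Equiv.Perm (Fin 6))))
      ≤ 12 := by
  have h : Fintype.card {g : Equiv.Perm (Fin 6) // ∀ x, g (x + 1) = g x + (g 1 - g 0)} = 12 := by
    decide +kernel
  rw [← h, ← Nat.card_eq_fintype_card]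
  refine Nat.card_le_card_of_injective (Subtype.map id fun g hg => ?_)
    (Subtype.map_injective _ Function.injective_id)
  have hmem := (Subgroup.mem_normalizer_iff.1 hg (finRotate 6)).1 (Subgroup.mem_zpowers _)
  obtain ⟨k, hk⟩ := Subgroup.mem_zpowers_iff.1 hmem
  obtain ⟨i, hi⟩ : ∃ i : Fin 6, finRotate 6 ^ k = finRotate 6 ^ (i : ℕ) := by
    refine ⟨⟨(k % 6).toNat, by omega⟩, ?_⟩
    rw [← zpow_natCast, Int.toNat_of_nonneg (by omega), ← zpow_mod_orderOf _ k,
      orderOf_finRotate_six, Nat.cast_ofNat]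
  rw [hi, eq_mul_inv_iff_mul_eq] at hk
  have hg (x : Fin 6) : g (x + 1) = g x + i := by
    rw [← finRotate_apply, ← Equiv.Perm.mul_apply, ← hk, Equiv.Perm.mul_apply,
      finRotate_six_pow_apply]
  intro x
  rw [id, hg x, ← zero_add (1 : Fin 6), hg 0, add_sub_cancel_left]

/-- The products of `finRotate 6 ^ j` for `j < 3` with elements of the group generated by the
three transpositions that `finRotate 6 ^ 3` is a product of. -/
def rotateFlips : Finset (Equiv.Perm (Fin 6)) :=
  (Finset.univ : Finset (Fin 3 × Fin 2 × Fin 2 × Fin 2)).image fun p =>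
    finRotate 6 ^ (p.1 : ℕ) * (Equiv.swap 0 3 ^ (p.2.1 : ℕ) *
      (Equiv.swap 1 4 ^ (p.2.2.1 : ℕ) * Equiv.swap 2 5 ^ (p.2.2.2 : ℕ)))

theorem card_rotateFlips : rotateFlips.card = 24 := by
  decide +kernel

theorem rotateFlips_subset {K : Subgroup (Equiv.Perm (Fin 6))} (hr : finRotate 6 ∈ K)
    (hs : Equiv.swap 0 3 ∈ K) : (rotateFlips : Set (Equiv.Perm (Fin 6))) ⊆ K := by
  have h1 : Equiv.swap 1 4 ∈ K := by
    rw [show Equiv.swap 1 4 = finRotate 6 * Equiv.swap 0 3 * (finRotate 6)⁻¹ by decide +kernel]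
    exact K.mul_mem (K.mul_mem hr hs) (K.inv_mem hr)
  have h2 : Equiv.swap 2 5 ∈ K := by
    rw [show Equiv.swap 2 5 = finRotate 6 * Equiv.swap 1 4 * (finRotate 6)⁻¹ by decide +kernel]
    exact K.mul_mem (K.mul_mem hr h1) (K.inv_mem hr)
  rw [rotateFlips, Finset.coe_image, Set.image_subset_iff]
  exact fun p _ => K.mul_mem (K.pow_mem hr _)
    (K.mul_mem (K.pow_mem hs _) (K.mul_mem (K.pow_mem h1 _) (K.pow_mem h2 _)))

theorem swap_mem_of_index_two {K : Subgroup (Equiv.Perm (Fin 6))} (hr : finRotate 6 ∈ K)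
    (hindex : (K.subgroupOf (Subgroup.centralizer {finRotate 6 ^ 3})).index = 2) :
    Equiv.swap 0 3 ∈ K := by
  have hw : Equiv.swap 1 2 * Equiv.swap 2 4 * Equiv.swap 4 5 ∈
      Subgroup.centralizer {finRotate 6 ^ 3} := by
    rw [Subgroup.mem_centralizer_singleton_iff]
    decide +kernel
  have hsq : (Equiv.swap 1 2 * Equiv.swap 2 4 * Equiv.swap 4 5) ^ 2 ∈ K :=
    Subgroup.sq_mem_of_index_two hindex ⟨_, hw⟩
  rw [show Equiv.swap 0 3 = finRotate 6 ^ 3 *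
    (Equiv.swap 1 2 * Equiv.swap 2 4 * Equiv.swap 4 5) ^ 2 by decide +kernel]
  exact K.mul_mem (K.pow_mem hr 3) hsq

theorem relIndex_mul_card {G : Type*} [Group G] {H K : Subgroup G} (h : H ≤ K) :
    H.relIndex K * Nat.card H = Nat.card K := by
  rw [← Nat.card_congr (Subgroup.subgroupOfEquivOfLe h).toEquiv]
  exact (H.subgroupOf K).index_mul_card

/-- Subgroups of order 6, 12, 24 or 48 that contain `finRotate 6` and centralize `finRotate 6 ^ 3`
are determined by their order. -/
theorem eq_of_finRotate_six_mem {K₁ K₂ : Subgroup (Equiv.Perm (Fin 6))}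
    (hr₁ : finRotate 6 ∈ K₁) (hr₂ : finRotate 6 ∈ K₂)
    (hc₁ : K₁ ≤ Subgroup.centralizer {finRotate 6 ^ 3})
    (hc₂ : K₂ ≤ Subgroup.centralizer {finRotate 6 ^ 3})
    (hcard : Nat.card K₁ = Nat.card K₂)
    (hn : Nat.card K₁ = 6 ∨ Nat.card K₁ = 12 ∨ Nat.card K₁ = 24 ∨ Nat.card K₁ = 48) :
    K₁ = K₂ := by
  rcases hn with hn | hn | hn | hn
  · have key {K : Subgroup (Equiv.Perm (Fin 6))} (hr : finRotate 6 ∈ K) (hK : Nat.card K = 6) :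
        Subgroup.zpowers (finRotate 6) = K := by
      refine Subgroup.eq_of_le_of_card_ge (Subgroup.zpowers_le.2 hr) ?_
      rw [Nat.card_zpowers, orderOf_finRotate_six, hK]
    rw [← key hr₁ hn, ← key hr₂ (hcard ▸ hn)]
  · have key {K : Subgroup (Equiv.Perm (Fin 6))} (hr : finRotate 6 ∈ K) (hK : Nat.card K = 12) :
        K = Subgroup.normalizer
          (Subgroup.zpowers (finRotate 6) : Set (Equiv.Perm (Fin 6))) := by
      have hle : Subgroup.zpowers (finRotate 6) ≤ K := Subgroup.zpowers_le.2 hr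
      refine Subgroup.eq_of_le_of_card_ge ?_
        (card_normalizer_zpowers_finRotate_six_le.trans hK.ge)
      have hindex : ((Subgroup.zpowers (finRotate 6)).subgroupOf K).index = 2 := by
        have := relIndex_mul_card hle
        rw [Nat.card_zpowers, orderOf_finRotate_six, hK] at this
        change (Subgroup.zpowers (finRotate 6)).relIndex K = 2
        omega
      have := Subgroup.normal_of_index_eq_two hindex
      exact (Subgroup.normal_subgroupOf_iff_le_normalizer hle).1 this
    rw [key hr₁ hn, key hr₂ (hcard ▸ hn)]
  · have key {K : Subgroup (Equiv.Perm (Fin 6))} (hr : finRotate 6 ∈ K)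
        (hc : K ≤ Subgroup.centralizer {finRotate 6 ^ 3}) (hK : Nat.card K = 24) :
        (rotateFlips : Set (Equiv.Perm (Fin 6))) = K := by
      refine Set.eq_of_subset_of_ncard_le ?_ ?_
      · refine rotateFlips_subset hr (swap_mem_of_index_two hr ?_)
        have := relIndex_mul_card hc
        rw [card_centralizer_finRotate_six_pow_three, hK] at this
        change K.relIndex _ = 2
        omega
      · rw [Set.ncard_coe_finset, card_rotateFlips, ← hK]
        rfl
    exact SetLike.coe_injective ((key hr₁ hc₁ hn).symm.trans (key hr₂ hc₂ (hcard ▸ hn)))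
  · have key {K : Subgroup (Equiv.Perm (Fin 6))}
        (hc : K ≤ Subgroup.centralizer {finRotate 6 ^ 3}) (hK : Nat.card K = 48) :
        K = Subgroup.centralizer {finRotate 6 ^ 3} :=
      Subgroup.eq_of_le_of_card_ge hc (by rw [card_centralizer_finRotate_six_pow_three, hK])
    rw [key hc₁ hn, key hc₂ (hcard ▸ hn)]

/-- A transitive subgroup of `S₆` whose order is divisible by 3 and whose center contains an
involution can be conjugated so that it contains `finRotate 6` and centralizes
`finRotate 6 ^ 3`. -/
theorem exists_conj_finRotate_six_mem {H : Subgroup (Equiv.Perm (Fin 6))}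
    (htrans : MulAction.IsPretransitive H (Fin 6)) (h3 : 3 ∣ Nat.card H)
    {z : H} (hz : z ∈ Subgroup.center H) (hz2 : orderOf z = 2) :
    ∃ g : Equiv.Perm (Fin 6), finRotate 6 ∈ H.map (MulAut.conj g).toMonoidHom ∧
      H.map (MulAut.conj g).toMonoidHom ≤ Subgroup.centralizer {finRotate 6 ^ 3} := by
  have : Fact (Nat.Prime 3) := ⟨Nat.prime_three⟩
  obtain ⟨c, hc⟩ := exists_prime_orderOf_dvd_card' 3 h3
  have hcomm : Commute c z := Subgroup.mem_center_iff.1 hz c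
  have hc3 : c ^ 3 = 1 := hc ▸ pow_orderOf_eq_one c
  have hz2' : z ^ 2 = 1 := hz2 ▸ pow_orderOf_eq_one z
  have hcz6 : (c * z) ^ 6 = 1 := by
    rw [hcomm.mul_pow, pow_mul c 3 2, pow_mul z 2 3, hc3, hz2', one_pow, one_pow, one_mul]
  have hcz3 : (c * z) ^ 3 = z := by
    rw [hcomm.mul_pow, hc3, one_mul, pow_succ, hz2', one_mul]
  have hcz2 : (c * z) ^ 2 ≠ 1 := by
    rw [hcomm.mul_pow, hz2', mul_one]
    exact pow_ne_one_of_lt_orderOf two_ne_zero (by omega)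
  have hfree (x : Fin 6) : z • x ≠ x := by
    intro hx
    have hz1 : z = 1 := by
      refine Subtype.ext (Equiv.ext fun y => ?_)
      obtain ⟨h, rfl⟩ := MulAction.exists_smul_eq H x y
      change z • h • x = h • x
      rw [← mul_smul, ← Subgroup.mem_center_iff.1 hz h, mul_smul, hx]
    simp [hz1] at hz2
  obtain ⟨g, hg⟩ := exists_conj_finRotate_six (r := ((c * z : H) : Equiv.Perm (Fin 6)))
    (by exact_mod_cast congrArg Subtype.val hcz6)
    (fun h => hcz2 (Subtype.ext (by simpa using h)))
    (fun x => by rw [← Subgroup.coe_pow, hcz3]; exact hfree x)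
  refine ⟨g, ⟨_, (c * z).2, hg⟩, ?_⟩
  rintro _ ⟨h, hh, rfl⟩
  rw [Subgroup.mem_centralizer_singleton_iff, ← hg, conj_pow, ← Subgroup.coe_pow, hcz3]
  have hhz : h * z = z * h := congrArg Subtype.val (Subgroup.mem_center_iff.1 hz ⟨h, hh⟩)
  simp only [MulEquiv.coe_toMonoidHom, MulAut.conj_apply]
  rw [conj_mul, conj_mul, hhz]

theorem card_C3rot : Nat.card C3rot = 3 := by
  rw [C3rot, Nat.card_zpowers]
  simpa using (isCycle_finRotate (n := 1)).orderOf

theorem card_C2cube : Nat.card C2cube = 8 := by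
  simp [Nat.card_eq_fintype_card]

/-- The involution of `C₂³` all of whose coordinates are nontrivial is central in any
semidirect product by a group permuting the coordinates. -/
theorem exists_central_involution_of_permuting {P : Type} [Group P]
    (φ : P →* Equiv.Perm (Fin 3)) :
    ∃ z ∈ Subgroup.center (C2cube ⋊[permHom.comp φ] P), orderOf z = 2 := by
  refine ⟨SemidirectProduct.inl fun _ => Multiplicative.ofAdd 1,
    Subgroup.mem_center_iff.2 fun g => ?_, ?_⟩
  · refine SemidirectProduct.ext ?_ (by simp)
    simp only [SemidirectProduct.mul_left, SemidirectProduct.left_inl,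
      SemidirectProduct.right_inl, map_one, MulAut.one_apply]
    exact mul_comm _ _
  · rw [orderOf_injective _ SemidirectProduct.inl_injective]
    refine orderOf_eq_prime (by decide) (by decide)

theorem exists_central_involution_and_card {G : Type} [Group G]
    (hG : Nonempty (G ≃* GrpC6) ∨ Nonempty (G ≃* GrpD6) ∨
      Nonempty (G ≃* GrpC23C3) ∨ Nonempty (G ≃* GrpC23S3)) :
    (∃ z ∈ Subgroup.center G, orderOf z = 2) ∧
      (Nat.card G = 6 ∨ Nat.card G = 12 ∨ Nat.card G = 24 ∨ Nat.card G = 48) := by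
  have transport {K : Type} [Group K] (e : G ≃* K)
      (h : ∃ z ∈ Subgroup.center K, orderOf z = 2) :
      ∃ z ∈ Subgroup.center G, orderOf z = 2 := by
    obtain ⟨z, hz, hz2⟩ := h
    refine ⟨e.symm z, Subgroup.mem_center_iff.2 fun g => e.injective ?_, ?_⟩
    · simpa using Subgroup.mem_center_iff.1 hz (e g)
    · rw [MulEquiv.orderOf_eq, hz2]
  rcases hG with ⟨⟨e⟩⟩ | ⟨⟨e⟩⟩ | ⟨⟨e⟩⟩ | ⟨⟨e⟩⟩
  · refine ⟨transport e ⟨Multiplicative.ofAdd 3, by simp [CommGroup.center_eq_top],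
      orderOf_eq_prime (by decide) (by decide)⟩, Or.inl ?_⟩
    rw [Nat.card_congr e.toEquiv]
    simp
  · refine ⟨transport e ⟨DihedralGroup.r 3, Subgroup.mem_center_iff.2 (by decide),
      orderOf_eq_prime (by decide) (by decide)⟩, Or.inr (Or.inl ?_)⟩
    rw [Nat.card_congr e.toEquiv, DihedralGroup.nat_card]
  · refine ⟨transport e (exists_central_involution_of_permuting _),
      Or.inr (Or.inr (Or.inl ?_))⟩
    rw [Nat.card_congr e.toEquiv, SemidirectProduct.card, card_C2cube, card_C3rot]
  · refine ⟨transport e (exists_central_involution_of_permuting (MonoidHom.id _)),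
      Or.inr (Or.inr (Or.inr ?_))⟩
    rw [Nat.card_congr e.toEquiv, SemidirectProduct.card, card_C2cube,
      Nat.card_eq_fintype_card, Fintype.card_perm]
    rfl

/-- any two transitive subgroups of `S₆` that are isomorphic to one of
`C₆`, `D₆`, `C₂³ ⋊ C₃`, `C₂³ ⋊ S₃` are conjugate in `S₆`. -/
theorem transitive_subgroups_conjugate (G : Type) [Group G]
    (hG : Nonempty (G ≃* GrpC6) ∨ Nonempty (G ≃* GrpD6) ∨
      Nonempty (G ≃* GrpC23C3) ∨ Nonempty (G ≃* GrpC23S3))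
    (H₁ H₂ : Subgroup (Equiv.Perm (Fin 6)))
    (htrans₁ : MulAction.IsPretransitive H₁ (Fin 6))
    (htrans₂ : MulAction.IsPretransitive H₂ (Fin 6))
    (hiso₁ : Nonempty (H₁ ≃* G)) (hiso₂ : Nonempty (H₂ ≃* G)) :
    ∃ g : Equiv.Perm (Fin 6), Subgroup.map (MulAut.conj g).toMonoidHom H₁ = H₂ := by
  have conjugate (H : Subgroup (Equiv.Perm (Fin 6)))
      (htrans : MulAction.IsPretransitive H (Fin 6)) (e : H ≃* G) :
      ∃ g : Equiv.Perm (Fin 6), finRotate 6 ∈ H.map (MulAut.conj g).toMonoidHom ∧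
        H.map (MulAut.conj g).toMonoidHom ≤ Subgroup.centralizer {finRotate 6 ^ 3} := by
    obtain ⟨⟨z, hz, hz2⟩, hn⟩ := exists_central_involution_and_card hG
    refine exists_conj_finRotate_six_mem htrans ?_ (z := e.symm z)
      (Subgroup.mem_center_iff.2 fun h => e.injective ?_) (by rw [MulEquiv.orderOf_eq, hz2])
    · rw [Nat.card_congr e.toEquiv]
      omega
    · simpa using Subgroup.mem_center_iff.1 hz (e h)
  obtain ⟨e₁⟩ := hiso₁
  obtain ⟨e₂⟩ := hiso₂
  obtain ⟨g₁, hr₁, hc₁⟩ := conjugate H₁ htrans₁ e₁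
  obtain ⟨g₂, hr₂, hc₂⟩ := conjugate H₂ htrans₂ e₂
  have hcard (H : Subgroup (Equiv.Perm (Fin 6))) (e : H ≃* G) (g : Equiv.Perm (Fin 6)) :
      Nat.card (H.map (MulAut.conj g).toMonoidHom) = Nat.card G := by
    rw [Subgroup.card_map_of_injective (MulAut.conj g).injective, Nat.card_congr e.toEquiv]
  have heq := eq_of_finRotate_six_mem hr₁ hr₂ hc₁ hc₂ ((hcard _ e₁ _).trans (hcard _ e₂ _).symm)
    (by rw [hcard _ e₁]; exact (exists_central_involution_and_card hG).2)
  refine ⟨g₂⁻¹ * g₁, ?_⟩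
  have hcomp (a b : Equiv.Perm (Fin 6)) (H : Subgroup (Equiv.Perm (Fin 6))) :
      H.map (MulAut.conj (a * b)).toMonoidHom =
        (H.map (MulAut.conj b).toMonoidHom).map (MulAut.conj a).toMonoidHom := by
    rw [Subgroup.map_map, map_mul]
    rfl
  rw [hcomp, heq, ← hcomp, inv_mul_cancel, map_one]
  exact Subgroup.map_id H₂
end
end

section
/- Let G = C2³⋊C3, where C3 acts on C2³ by cyclically permuting coordinates, let σ = ((0,0,0),(1 2 3)), n1 = ((1,0,0),e), n2 = ((0,1,0),e), and let H = {((a,b,0),e) : a,b ∈ C2} be the subgroup of order 4. Set S = H ∪ σH ∪ σ²H ⊆ G. Then: (a) {g ∈ G : gS = S} = ⟨σ⟩, the cyclic subgroup of order 3 generated by σ; (b) S^{-1} = {s^{-1} : s ∈ S} equals the union of the four left cosets ⟨σ⟩ ∪ n1⟨σ⟩ ∪ n2⟨σ⟩ ∪ n1n2⟨σ⟩. (In the Galois interpretation: for a sextic CM field K with Gal(L/ℚ) ≅ C2³⋊C3, H = Gal(L/K) and S the lift of the CM type Φ₁ = {id|_K, σ|_K, σ²|_K}, this says the reflex field of Φ₁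 is the degree-8 fixed field of ⟨σ⟩ and the reflex CM type is {id, n1, n2, n1n2} restricted to it.) -/
open scoped Pointwise

noncomputable section

/-- The element `σ = ((0,0,0), (1 2 3))` of `C₂³ ⋊ C₃`. -/
def sigma0 : GrpC23C3 := ⟨1, ⟨finRotate 3, Subgroup.mem_zpowers _⟩⟩

/-- The element `n₁ = ((1,0,0), e)` of `C₂³ ⋊ C₃`. -/
def n1elt : GrpC23C3 := ⟨fun i => if i = 0 then Multiplicative.ofAdd 1 else 1, 1⟩

/-- The element `n₂ = ((0,1,0), e)` of `C₂³ ⋊ C₃`. -/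
def n2elt : GrpC23C3 := ⟨fun i => if i = 1 then Multiplicative.ofAdd 1 else 1, 1⟩

/-- The subgroup `H = {((a,b,0), e)}` of order 4, as a subset of `C₂³ ⋊ C₃`. -/
def Hset : Set GrpC23C3 := {x | x.right = 1 ∧ x.left 2 = 1}

/-- The subset `S = H ∪ σH ∪ σ²H` of `C₂³ ⋊ C₃`. -/
def Sset : Set GrpC23C3 := Hset ∪ (sigma0 * ·) '' Hset ∪ (sigma0 ^ 2 * ·) '' Hset

lemma C2_eq_one_or (a : Multiplicative (ZMod 2)) : a = 1 ∨ a = Multiplicative.ofAdd 1 := by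
  revert a; decide

lemma mem_Hset {x : GrpC23C3} : x ∈ Hset ↔ x.right = 1 ∧ x.left 2 = 1 := Iff.rfl

lemma mul_left_apply (x y : GrpC23C3) (i : Fin 3) :
    (x * y).left i = x.left i * y.left ((x.right : Equiv.Perm (Fin 3))⁻¹ i) := rfl

lemma inv_left_apply (x : GrpC23C3) (i : Fin 3) :
    x⁻¹.left i = (x.left ((x.right : Equiv.Perm (Fin 3)) i))⁻¹ := by
  rw [SemidirectProduct.inv_left, map_inv, Pi.inv_apply]
  rfl

lemma sigma0_eq_inr : sigma0 = SemidirectProduct.inr ⟨finRotate 3, Subgroup.mem_zpowers _⟩ := rfl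

lemma mem_zpowers_sigma0 {x : GrpC23C3} : x ∈ Subgroup.zpowers sigma0 ↔ x.left = 1 := by
  rw [sigma0_eq_inr]
  constructor
  · rintro ⟨k, rfl⟩
    simp only [← map_zpow, SemidirectProduct.left_inr]
  · intro h
    obtain ⟨k, hk⟩ := x.right.2
    refine ⟨k, ?_⟩
    beta_reduce
    rw [← map_zpow]
    exact SemidirectProduct.ext h.symm (Subtype.ext hk)

lemma C3rot_cases (r : C3rot) : (r : Equiv.Perm (Fin 3)) = 1 ∨
    (r : Equiv.Perm (Fin 3)) = finRotate 3 ∨ (r : Equiv.Perm (Fin 3)) = finRotate 3 ^ 2 := by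
  obtain ⟨r, k, rfl⟩ := r
  have h3 : finRotate 3 ^ (3 : ℤ) = 1 := by decide
  have hk : finRotate 3 ^ k = finRotate 3 ^ (k % 3) := by
    conv_lhs => rw [← Int.mul_ediv_add_emod k 3, zpow_add, zpow_mul, h3, one_zpow, one_mul]
  have h : k % 3 = 0 ∨ k % 3 = 1 ∨ k % 3 = 2 := by omega
  simp only [hk]
  rcases h with h | h | h <;> rw [h]
  · exact Or.inl rfl
  · exact Or.inr (Or.inl (zpow_one _))
  · exact Or.inr (Or.inr rfl)

lemma C3rot_exists_apply_two (i : Fin 3) : ∃ r : C3rot, (r : Equiv.Perm (Fin 3)) 2 = i := by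
  fin_cases i
  · exact ⟨⟨finRotate 3, Subgroup.mem_zpowers _⟩, by decide⟩
  · exact ⟨⟨finRotate 3 ^ 2, pow_mem (Subgroup.mem_zpowers _) 2⟩, by decide⟩
  · exact ⟨1, rfl⟩

lemma mul_mem_Hset_iff (r : C3rot) (x : GrpC23C3) :
    (SemidirectProduct.inr r)⁻¹ * x ∈ Hset ↔
      (x.right : Equiv.Perm (Fin 3)) = r ∧ x.left ((r : Equiv.Perm (Fin 3)) 2) = 1 := by
  rw [mem_Hset, SemidirectProduct.mul_right, mul_left_apply, inv_left_apply]
  simp only [SemidirectProduct.inv_right, SemidirectProduct.right_inr,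
    SemidirectProduct.left_inr, Pi.one_apply, inv_one, one_mul, inv_mul_eq_one, Subgroup.coe_inv,
    inv_inv, Subtype.ext_iff, @eq_comm _ (r : Equiv.Perm (Fin 3))]

lemma mem_Sset {x : GrpC23C3} :
    x ∈ Sset ↔ x.left ((x.right : Equiv.Perm (Fin 3)) 2) = 1 := by
  have h0 := mul_mem_Hset_iff 1 x
  have h1 := mul_mem_Hset_iff ⟨finRotate 3, Subgroup.mem_zpowers _⟩ x
  have h2 := mul_mem_Hset_iff (⟨finRotate 3, Subgroup.mem_zpowers _⟩ ^ 2) x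
  rw [map_one, inv_one, one_mul] at h0
  rw [← sigma0_eq_inr] at h1
  rw [map_pow, ← sigma0_eq_inr] at h2
  rw [Sset, Set.image_mul_left, Set.image_mul_left, Set.mem_union, Set.mem_union,
    Set.mem_preimage, Set.mem_preimage, h0, h1, h2]
  constructor
  · rintro ((⟨h, h'⟩ | ⟨h, h'⟩) | ⟨h, h'⟩) <;> rwa [h]
  · intro h
    rcases C3rot_cases x.right with hr | hr | hr <;> rw [hr] at h
    · exact Or.inl (Or.inl ⟨hr, h⟩)
    · exact Or.inl (Or.inr ⟨hr, h⟩)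
    · exact Or.inr ⟨hr, h⟩

lemma mul_mem_Sset_iff (g x : GrpC23C3) :
    g * x ∈ Sset ↔ g.left ((g.right : Equiv.Perm (Fin 3)) ((x.right : Equiv.Perm (Fin 3)) 2)) *
      x.left ((x.right : Equiv.Perm (Fin 3)) 2) = 1 := by
  rw [mem_Sset, mul_left_apply]
  simp

lemma inv_mem_Sset_iff (x : GrpC23C3) : x⁻¹ ∈ Sset ↔ x.left 2 = 1 := by
  rw [mem_Sset, inv_left_apply]
  simp

lemma mem_image_mul_zpowers_sigma0 {n x : GrpC23C3} (hn : n.right = 1) :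
    x ∈ (n * ·) '' (Subgroup.zpowers sigma0 : Set GrpC23C3) ↔ x.left = n.left := by
  rw [Set.image_mul_left, Set.mem_preimage, SetLike.mem_coe, mem_zpowers_sigma0]
  simp only [funext_iff, mul_left_apply, inv_left_apply, SemidirectProduct.inv_right, hn]
  simp [inv_mul_eq_one, @eq_comm _ (n.left _)]

/-- in `G = C₂³ ⋊ C₃`, with `S = H ∪ σH ∪ σ²H` as above:
(a) the left stabilizer `{g ∈ G : gS = S}` is the cyclic subgroup `⟨σ⟩` of order 3;
(b) `S⁻¹` is the union of the four left cosets `⟨σ⟩ ∪ n₁⟨σ⟩ ∪ n₂⟨σ⟩ ∪ n₁n₂⟨σ⟩`. -/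
theorem stabilizer_and_inverse_of_lifted_cm_type :
    MulAction.stabilizer GrpC23C3 Sset = Subgroup.zpowers sigma0 ∧
    Sset⁻¹ = (Subgroup.zpowers sigma0 : Set GrpC23C3) ∪
        (n1elt * ·) '' (Subgroup.zpowers sigma0 : Set GrpC23C3) ∪
        (n2elt * ·) '' (Subgroup.zpowers sigma0 : Set GrpC23C3) ∪
        (n1elt * n2elt * ·) '' (Subgroup.zpowers sigma0 : Set GrpC23C3) := by
  constructor
  · ext g
    rw [MulAction.mem_stabilizer_set, mem_zpowers_sigma0]
    simp only [smul_eq_mul, mul_mem_Sset_iff]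
    simp only [mem_Sset]
    constructor
    · intro h
      funext i
      obtain ⟨t, ht⟩ := C3rot_exists_apply_two i
      have := h (SemidirectProduct.inr (g.right⁻¹ * t))
      simpa [ht] using this
    · intro h x
      simp [h]
  · ext x
    rw [Set.mem_inv, inv_mem_Sset_iff, Set.mem_union, Set.mem_union, Set.mem_union,
      mem_image_mul_zpowers_sigma0 rfl, mem_image_mul_zpowers_sigma0 rfl,
      mem_image_mul_zpowers_sigma0 (by rfl), SetLike.mem_coe, mem_zpowers_sigma0]
    generalize x.left = v
    simp only [funext_iff, Fin.forall_fin_succ, mul_left_apply, n1elt, n2elt]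
    rcases C2_eq_one_or (v 0) with h0 | h0 <;> rcases C2_eq_one_or (v 1) with h1 | h1 <;>
      simp [h0, h1]
end
end
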